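/- (Lemma 3.1(b), uniform lower bound) Assume (h1), (h2), (h3) and let f satisfy (f1)–(f4). Then there exists τ > 0, independent of u, such that for every u ∈ X with ‖u‖ = 1 and every t > 0 with t u ∈ N, one has t ≥ τ. -/

import Mathlib

open MeasureTheory Filter

noncomputable section

namespace ZeroMass

/-- The ambient Euclidean space `ℝ^N`. -/
abbrev EN (N : ℕ) := EuclideanSpace ℝ (Fin N)

/-- The critical fractional Sobolev exponent `2*_α = 2N/(N-2α)`. -/
def critExp (N : ℕ) (α : ℝ) : ℝ := 2 * N / (N - 2 * α)

/-- The square of the Gagliardo seminorm `[u]²`. -/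
def gagSq (N : ℕ) (α : ℝ) (u : EN N → ℝ) : ENNReal :=
  ∫⁻ p : EN N × EN N, ENNReal.ofReal ((u p.1 - u p.2) ^ 2 / ‖p.1 - p.2‖ ^ ((N : ℝ) + 2 * α))

/-- The square of the full norm `‖u‖² = [u]² + ∫ V u²`. -/
def normSq {N : ℕ} (α : ℝ) (V : EN N → ℝ) (u : EN N → ℝ) : ENNReal :=
  gagSq N α u + ∫⁻ x, ENNReal.ofReal (V x * u x ^ 2)

/-- Membership in the space `X`. -/
def memX {N : ℕ} (α : ℝ) (V : EN N → ℝ) (u : EN N → ℝ) : Prop :=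
  Measurable u ∧ normSq α V u < ⊤

/-- The norm of `X`, i.e. `‖u‖ = ([u]² + ∫ V u²)^{1/2}`. -/
def Xnorm {N : ℕ} (α : ℝ) (V : EN N → ℝ) (u : EN N → ℝ) : ℝ :=
  ((normSq α V u).toReal) ^ (1 / 2 : ℝ)

/-- The primitive `F(t) = ∫₀ᵗ f(τ) dτ`. -/
def prim (f : ℝ → ℝ) (t : ℝ) : ℝ := ∫ τ in (0 : ℝ)..t, f τ

/-- The energy functional `J`. -/
def Jfun {N : ℕ} (α : ℝ) (V K : EN N → ℝ) (f : ℝ → ℝ) (u : EN N → ℝ) : ℝ :=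
  (1 / 2) * (normSq α V u).toReal - ∫ x, K x * prim f (u x)

/-- The pairing `⟨J'(u), φ⟩`. -/
def Jd {N : ℕ} (α : ℝ) (V K : EN N → ℝ) (f : ℝ → ℝ) (u φ : EN N → ℝ) : ℝ :=
  (∫ p : EN N × EN N, (u p.1 - u p.2) * (φ p.1 - φ p.2) / ‖p.1 - p.2‖ ^ ((N : ℝ) + 2 * α))
    + (∫ x, V x * u x * φ x) - ∫ x, K x * f (u x) * φ x

/-- Positive part `u⁺ = max(u, 0)`. -/
def uplus {N : ℕ} (u : EN N → ℝ) : EN N → ℝ := fun x => max (u x) 0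

/-- Negative part `u⁻ = min(u, 0)`. -/
def uminus {N : ℕ} (u : EN N → ℝ) : EN N → ℝ := fun x => min (u x) 0

/-- `u` is not almost everywhere zero. -/
def NotAEZero {N : ℕ} (u : EN N → ℝ) : Prop :=
  ¬ (u =ᵐ[(volume : Measure (EN N))] (0 : EN N → ℝ))

/-- Hypothesis (h1): `V, K > 0` everywhere and `K` bounded. -/
def H1 {N : ℕ} (V K : EN N → ℝ) : Prop :=
  (∀ x, 0 < V x) ∧ (∀ x, 0 < K x) ∧ ∃ C : ℝ, ∀ x, K x ≤ C

/-- Hypothesis (h2): uniform vanishing of `∫_{A_n ∩ {|x| ≥ r}} K`. -/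
def H2 {N : ℕ} (K : EN N → ℝ) : Prop :=
  ∀ (A : ℕ → Set (EN N)) (R : ℝ), 0 < R → (∀ n, MeasurableSet (A n)) →
    (∀ n, volume (A n) ≤ ENNReal.ofReal R) →
    ∀ ε : ℝ, 0 < ε → ∃ r₀ : ℝ, ∀ r : ℝ, r₀ ≤ r → ∀ n,
      (∫⁻ x in A n ∩ {x : EN N | r ≤ ‖x‖}, ENNReal.ofReal (K x)) ≤ ENNReal.ofReal ε

/-- Hypothesis (h3): `K/V` is bounded. -/
def H3 {N : ℕ} (V K : EN N → ℝ) : Prop := ∃ C : ℝ, ∀ x, K x / V x ≤ C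

/-- Hypothesis (h4) with exponent `m`. -/
def H4 {N : ℕ} (α : ℝ) (V K : EN N → ℝ) (m : ℝ) : Prop :=
  2 < m ∧ m < critExp N α ∧
    Tendsto (fun x : EN N => K x / V x ^ ((critExp N α - m) / (critExp N α - 2)))
      (comap (fun x : EN N => ‖x‖) atTop) (nhds 0)

/-- Hypothesis (f1): `f(t)/|t| → 0` as `t → 0`. -/
def Cf1 (f : ℝ → ℝ) : Prop :=
  Tendsto (fun t : ℝ => f t / |t|) (nhdsWithin 0 {(0 : ℝ)}ᶜ) (nhds 0)

/-- Hypothesis (f̃1): `limsup_{t→0} f(t)/|t|^{m-1} < ∞`. -/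
def Cf1' (f : ℝ → ℝ) (m : ℝ) : Prop :=
  ∃ C : ℝ, ∀ᶠ t in nhdsWithin (0 : ℝ) {(0 : ℝ)}ᶜ, f t / |t| ^ (m - 1) ≤ C

/-- Hypothesis (f2) with exponent `p`: `f(t)/|t|^{p-1} → 0` as `|t| → ∞`. -/
def Cf2 (f : ℝ → ℝ) (p : ℝ) : Prop :=
  Tendsto (fun t : ℝ => f t / |t| ^ (p - 1)) (comap (fun t : ℝ => |t|) atTop) (nhds 0)

/-- Hypothesis (f3): `F(t)/t² → +∞` as `|t| → ∞`. -/
def Cf3 (f : ℝ → ℝ) : Prop :=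
  Tendsto (fun t : ℝ => prim f t / t ^ 2) (comap (fun t : ℝ => |t|) atTop) atTop

/-- Hypothesis (f4): `t ↦ f(t)/|t|` is strictly increasing on `ℝ \ {0}`. -/
def Cf4 (f : ℝ → ℝ) : Prop :=
  ∀ s t : ℝ, s ≠ 0 → t ≠ 0 → s < t → f s / |s| < f t / |t|

/-- Nehari manifold membership, formulated with the pairing `⟨J'(u), u⟩ = 0`. -/
def memNehari {N : ℕ} (α : ℝ) (V K : EN N → ℝ) (f : ℝ → ℝ) (u : EN N → ℝ) : Prop :=
  memX α V u ∧ NotAEZero u ∧ Jd α V K f u u = 0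

/-- Nehari manifold membership, formulated as `‖u‖² = ∫ K f(u) u`. -/
def memNehari2 {N : ℕ} (α : ℝ) (V K : EN N → ℝ) (f : ℝ → ℝ) (u : EN N → ℝ) : Prop :=
  memX α V u ∧ NotAEZero u ∧ (normSq α V u).toReal = ∫ x, K x * f (u x) * u x

/-- Nodal (sign-changing) Nehari set membership. -/
def memM {N : ℕ} (α : ℝ) (V K : EN N → ℝ) (f : ℝ → ℝ) (u : EN N → ℝ) : Prop :=
  memNehari α V K f u ∧ NotAEZero (uplus u) ∧ NotAEZero (uminus u) ∧
    Jd α V K f u (uplus u) = 0 ∧ Jd α V K f u (uminus u) = 0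

/-- Weak convergence in `X` of the sequence `u` to `w`. -/
def weakConv {N : ℕ} (α : ℝ) (V : EN N → ℝ) (u : ℕ → EN N → ℝ) (w : EN N → ℝ) : Prop :=
  ∀ v : EN N → ℝ, memX α V v →
    Tendsto (fun n =>
      (∫ p : EN N × EN N,
        ((u n p.1 - w p.1) - (u n p.2 - w p.2)) * (v p.1 - v p.2)
          / ‖p.1 - p.2‖ ^ ((N : ℝ) + 2 * α))
      + ∫ x, V x * (u n x - w x) * v x) atTop (nhds 0)

end ZeroMass

/-- Cauchy-Schwarz on a set, for `g` whose square is dominated by a multiple of `h`. -/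
theorem lintegral_le_ofReal_sqrt {X : Type*} [MeasurableSpace X] {μ : Measure X} {s : Set X}
    (hs : MeasurableSet s) {g h : X → ENNReal} (hg : AEMeasurable g μ) (hh : AEMeasurable h μ)
    {a M b : ℝ} (ha : 0 ≤ a) (hM : 0 ≤ M) (hb : 0 ≤ b)
    (hle : ∀ p ∈ s, g p ^ 2 ≤ ENNReal.ofReal M * h p) (hμ : μ s ≤ ENNReal.ofReal a)
    (hint : ∫⁻ p, h p ∂μ ≤ ENNReal.ofReal b) :
    ∫⁻ p in s, g p ∂μ ≤ ENNReal.ofReal (Real.sqrt (a * (M * b))) := by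
  have hcs := ENNReal.lintegral_mul_le_Lp_mul_Lq (μ.restrict s) Real.HolderConjugate.two_two
    (hg.restrict (s := s)) (aemeasurable_const (b := (1 : ENNReal)))
  have h2 : ∫⁻ p in s, g p ^ (2 : ℝ) ∂μ ≤ ENNReal.ofReal (M * b) := by
    calc ∫⁻ p in s, g p ^ (2 : ℝ) ∂μ ≤ ∫⁻ p in s, ENNReal.ofReal M * h p ∂μ :=
          setLIntegral_mono' hs fun p hp => by simpa using hle p hp
      _ = ENNReal.ofReal M * ∫⁻ p in s, h p ∂μ := lintegral_const_mul'' _ hh.restrict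
      _ ≤ ENNReal.ofReal M * ENNReal.ofReal b := by
          gcongr
          exact (setLIntegral_le_lintegral _ _).trans hint
      _ = _ := (ENNReal.ofReal_mul hM).symm
  simp only [Pi.mul_apply, mul_one, ENNReal.one_rpow, lintegral_const, one_mul,
    Measure.restrict_apply_univ] at hcs
  calc ∫⁻ p in s, g p ∂μ ≤ _ := hcs
    _ ≤ ENNReal.ofReal (M * b) ^ (1 / 2 : ℝ) * ENNReal.ofReal a ^ (1 / 2 : ℝ) := by gcongr
    _ = _ := by
      rw [← ENNReal.mul_rpow_of_nonneg _ _ (by norm_num), ← ENNReal.ofReal_mul (by positivity),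
        ENNReal.ofReal_rpow_of_nonneg (by positivity) (by norm_num), Real.sqrt_eq_rpow, mul_comm a]

theorem le_add_ofReal_geometric_of_le_succ {b : ℕ → ENNReal} {C q : ℝ} (hC : 0 ≤ C) (hq : 0 ≤ q)
    (hq1 : q < 1) (h : ∀ n, b n ≤ b (n + 1) + ENNReal.ofReal (C * q ^ n)) (n : ℕ) :
    b 0 ≤ b n + ENNReal.ofReal (C / (1 - q)) := by
  have key : b 0 ≤ b n + ENNReal.ofReal (C / (1 - q) * (1 - q ^ n)) := by
    induction n with
    | zero => simp
    | succ n ih =>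
      have hn : q ^ n ≤ 1 := pow_le_one₀ hq hq1.le
      have h1q : 0 < 1 - q := by linarith
      refine ih.trans ((add_le_add_left (h n) _).trans (le_of_eq ?_))
      rw [add_assoc, ← ENNReal.ofReal_add (by positivity)
        (mul_nonneg (by positivity) (by linarith))]
      congr 2
      field_simp
      ring
  have h1q : 0 < 1 - q := by linarith
  refine key.trans (add_le_add_right (ENNReal.ofReal_le_ofReal ?_) _)
  exact mul_le_of_le_one_right (by positivity) (by linarith [pow_nonneg hq n])

theorem le_add_ofReal_geometric_of_succ_le {b : ℕ → ENNReal} {C q : ℝ} (hC : 0 ≤ C) (hq : 0 ≤ q)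
    (hq1 : q < 1) (h : ∀ n, b (n + 1) ≤ b n + ENNReal.ofReal (C * q ^ n)) (n : ℕ) :
    b n ≤ b 0 + ENNReal.ofReal (C / (1 - q)) := by
  have key : b n ≤ b 0 + ENNReal.ofReal (C / (1 - q) * (1 - q ^ n)) := by
    induction n with
    | zero => simp
    | succ n ih =>
      have hn : q ^ n ≤ 1 := pow_le_one₀ hq hq1.le
      have h1q : 0 < 1 - q := by linarith
      refine (h n).trans ((add_le_add_left ih _).trans (le_of_eq ?_))
      rw [add_assoc, ← ENNReal.ofReal_add (mul_nonneg (by positivity) (by linarith))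
        (by positivity)]
      congr 2
      field_simp
      ring
  have h1q : 0 < 1 - q := by linarith
  refine key.trans (add_le_add_right (ENNReal.ofReal_le_ofReal ?_) _)
  exact mul_le_of_le_one_right (by positivity) (by linarith [pow_nonneg hq n])

namespace ZeroMass

/-- The Gagliardo kernel `|u(x) - u(y)|² / |x - y|^{N + 2α}`. -/
def gagKer {N : ℕ} (α : ℝ) (u : EN N → ℝ) (p : EN N × EN N) : ENNReal :=
  ENNReal.ofReal ((u p.1 - u p.2) ^ 2 / ‖p.1 - p.2‖ ^ ((N : ℝ) + 2 * α))

/-- The mean of `|u|` over a ball. -/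
def ballAvg {N : ℕ} (u : EN N → ℝ) (x : EN N) (r : ℝ) : ENNReal :=
  (∫⁻ y in Metric.ball x r, ‖u y‖ₑ) / volume (Metric.ball x r)

/-- The volume of the unit ball of `ℝ^N`. -/
def unitBallVol (N : ℕ) : ℝ := (volume (Metric.ball (0 : EN N) 1)).toReal

theorem unitBallVol_pos (N : ℕ) : 0 < unitBallVol N :=
  ENNReal.toReal_pos (Metric.measure_ball_pos _ _ one_pos).ne' measure_ball_lt_top.ne

theorem volume_ball_eq {N : ℕ} (x : EN N) {r : ℝ} (hr : 0 < r) :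
    volume (Metric.ball x r) = ENNReal.ofReal (unitBallVol N * r ^ (N : ℝ)) := by
  rw [Measure.addHaar_ball_of_pos _ _ hr, finrank_euclideanSpace_fin,
    ENNReal.ofReal_mul (unitBallVol_pos N).le, unitBallVol,
    ENNReal.ofReal_toReal measure_ball_lt_top.ne, Real.rpow_natCast, mul_comm]

theorem measurable_gagKer {N : ℕ} (α : ℝ) {u : EN N → ℝ} (hu : Measurable u) :
    Measurable (gagKer α u) := by
  unfold gagKer
  fun_prop

theorem enorm_sub_sq_le_gagKer {N : ℕ} {α : ℝ} (hα : 0 < α) (u : EN N → ℝ) {d : ℝ}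
    {p : EN N × EN N} (hp : ‖p.1 - p.2‖ ≤ d) :
    ‖u p.1 - u p.2‖ₑ ^ 2 ≤ ENNReal.ofReal (d ^ ((N : ℝ) + 2 * α)) * gagKer α u p := by
  have hd : 0 ≤ d := (norm_nonneg _).trans hp
  rw [gagKer, ← ENNReal.ofReal_mul (by positivity), Real.enorm_eq_ofReal_abs,
    ← ENNReal.ofReal_pow (abs_nonneg _), sq_abs]
  refine ENNReal.ofReal_le_ofReal ?_
  rcases (norm_nonneg (p.1 - p.2)).eq_or_lt with h0 | h0
  · have : p.1 = p.2 := sub_eq_zero.1 (norm_eq_zero.1 h0.symm)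
    simp [this]
  · rw [mul_div_assoc', le_div_iff₀ (by positivity), mul_comm]
    gcongr

theorem ballAvg_le_ballAvg_add {N : ℕ} {α : ℝ} (hα : 0 < α) {u : EN N → ℝ} (hu : Measurable u)
    (hgag : gagSq N α u ≤ 1) {x y : EN N} {r s d : ℝ} (hr : 0 < r) (hs : 0 < s)
    (hd : dist x y + r + s ≤ d) :
    ballAvg u x r ≤ ballAvg u y s + ENNReal.ofReal (Real.sqrt (d ^ ((N : ℝ) + 2 * α) /
      (unitBallVol N * r ^ (N : ℝ) * (unitBallVol N * s ^ (N : ℝ))))) := by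
  have hc := unitBallVol_pos N
  have hd0 : 0 ≤ d := by linarith [dist_nonneg (x := x) (y := y)]
  set R := unitBallVol N * r ^ (N : ℝ) with hR
  set S := unitBallVol N * s ^ (N : ℝ) with hS
  have hRp : 0 < R := by positivity
  have hSp : 0 < S := by positivity
  have hmu : Measurable fun y => ‖u y‖ₑ := hu.enorm
  have hB : MeasurableSet (Metric.ball x r ×ˢ Metric.ball y s) :=
    Metric.isOpen_ball.measurableSet.prod Metric.isOpen_ball.measurableSet
  have hcs : ∫⁻ p in Metric.ball x r ×ˢ Metric.ball y s, ‖u p.1 - u p.2‖ₑ ≤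
      ENNReal.ofReal (Real.sqrt (R * S * (d ^ ((N : ℝ) + 2 * α) * 1))) := by
    refine lintegral_le_ofReal_sqrt hB (h := gagKer α u) (by fun_prop)
      (measurable_gagKer α hu).aemeasurable (by positivity) (by positivity) zero_le_one ?_ ?_ ?_
    · intro p hp
      refine enorm_sub_sq_le_gagKer hα u ?_
      have h1 : dist p.1 x < r := hp.1
      have h2 : dist p.2 y < s := hp.2
      rw [← dist_eq_norm]
      have := dist_triangle4 p.1 x y p.2
      rw [dist_comm y] at this
      linarith
    · rw [Measure.volume_eq_prod, Measure.prod_prod, volume_ball_eq x hr, volume_ball_eq y hs,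
        ← ENNReal.ofReal_mul hRp.le]
    · rw [ENNReal.ofReal_one]
      exact hgag
  have hmain : (∫⁻ z in Metric.ball x r, ‖u z‖ₑ) * ENNReal.ofReal S ≤
      ENNReal.ofReal R * (∫⁻ z in Metric.ball y s, ‖u z‖ₑ) +
        ENNReal.ofReal (Real.sqrt (R * S * (d ^ ((N : ℝ) + 2 * α) * 1))) := by
    have e1 : ∫⁻ p in Metric.ball x r ×ˢ Metric.ball y s, ‖u p.1‖ₑ =
        (∫⁻ z in Metric.ball x r, ‖u z‖ₑ) * ENNReal.ofReal S := by
      rw [Measure.volume_eq_prod, ← Measure.prod_restrict, lintegral_prod _ (by fun_prop)]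
      simp only [lintegral_const, Measure.restrict_apply_univ]
      rw [lintegral_mul_const _ hmu, volume_ball_eq y hs]
    have e2 : ∫⁻ p in Metric.ball x r ×ˢ Metric.ball y s, ‖u p.2‖ₑ =
        ENNReal.ofReal R * (∫⁻ z in Metric.ball y s, ‖u z‖ₑ) := by
      rw [Measure.volume_eq_prod, ← Measure.prod_restrict, lintegral_prod _ (by fun_prop)]
      simp only [lintegral_const, Measure.restrict_apply_univ]
      rw [volume_ball_eq x hr, mul_comm]
    rw [← e1, ← e2]
    refine le_trans ?_ (add_le_add_right hcs _)
    rw [← lintegral_add_left (by fun_prop)]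
    refine lintegral_mono fun p => ?_
    simpa using enorm_add_le (u p.2) (u p.1 - u p.2)
  have hR0 : ENNReal.ofReal R ≠ 0 := by simpa using hRp
  have hS0 : ENNReal.ofReal S ≠ 0 := by simpa using hSp
  unfold ballAvg
  rw [volume_ball_eq x hr, volume_ball_eq y hs, ← hR, ← hS]
  rw [ENNReal.div_le_iff hR0 ENNReal.ofReal_ne_top, add_mul, ← ENNReal.ofReal_mul (by positivity)]
  rw [← ENNReal.mul_le_mul_iff_left hS0 ENNReal.ofReal_ne_top]
  refine hmain.trans (le_of_eq ?_)
  rw [add_mul, ← ENNReal.ofReal_mul (by positivity)]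
  congr 1
  · rw [mul_right_comm, ENNReal.div_mul_cancel hS0 ENNReal.ofReal_ne_top, mul_comm]
  · congr 1
    have e : R * S * (d ^ ((N : ℝ) + 2 * α) * 1) =
        d ^ ((N : ℝ) + 2 * α) / (R * S) * ((R * S) * (R * S)) := by
      field_simp
    rw [e, Real.sqrt_mul (by positivity), Real.sqrt_mul_self (by positivity)]
    exact (mul_assoc _ _ _).symm

theorem sqrt_rpow_div_ball_scale {N : ℕ} {α c ρ k a b : ℝ} (hc : 0 < c) (hρ : 0 < ρ) (hk : 0 < k)
    (ha : 0 < a) (hb : 0 < b) :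
    Real.sqrt ((ρ * k) ^ ((N : ℝ) + 2 * α) / (c * (ρ * a) ^ (N : ℝ) * (c * (ρ * b) ^ (N : ℝ)))) =
      Real.sqrt (k ^ ((N : ℝ) + 2 * α) / (c * a ^ (N : ℝ) * (c * b ^ (N : ℝ)))) *
        ρ ^ (-(((N : ℝ) - 2 * α) / 2)) := by
  have e : ρ ^ ((N : ℝ) + 2 * α) =
      ρ ^ (N : ℝ) * ρ ^ (N : ℝ) * (ρ ^ (-(((N : ℝ) - 2 * α) / 2)) *
        ρ ^ (-(((N : ℝ) - 2 * α) / 2))) := by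
    rw [← Real.rpow_add hρ, ← Real.rpow_add hρ, ← Real.rpow_add hρ]
    congr 1
    ring
  rw [Real.mul_rpow hρ.le hk.le, Real.mul_rpow hρ.le ha.le, Real.mul_rpow hρ.le hb.le, e]
  have e2 : ρ ^ (N : ℝ) * ρ ^ (N : ℝ) * (ρ ^ (-(((N : ℝ) - 2 * α) / 2)) *
        ρ ^ (-(((N : ℝ) - 2 * α) / 2))) * k ^ ((N : ℝ) + 2 * α) /
        (c * (ρ ^ (N : ℝ) * a ^ (N : ℝ)) * (c * (ρ ^ (N : ℝ) * b ^ (N : ℝ)))) =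
      k ^ ((N : ℝ) + 2 * α) / (c * a ^ (N : ℝ) * (c * b ^ (N : ℝ))) *
        (ρ ^ (-(((N : ℝ) - 2 * α) / 2)) * ρ ^ (-(((N : ℝ) - 2 * α) / 2))) := by
    field_simp
  rw [e2, Real.sqrt_mul (by positivity), Real.sqrt_mul_self (by positivity)]

/-- Means of `|u|` over balls are controlled by the mean over the unit ball, uniformly over all
`u` with Gagliardo seminorm at most one. -/
theorem exists_ballAvg_le {N : ℕ} {α : ℝ} (hα : 0 < α) (hN : 2 * α < N) :
    ∃ M : ℝ, 0 ≤ M ∧ ∀ u : EN N → ℝ, Measurable u → gagSq N α u ≤ 1 → ∀ (x : EN N) (r : ℝ),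
      0 < r → ballAvg u x r ≤
        ballAvg u 0 1 + ENNReal.ofReal (M * (1 + r ^ (-(((N : ℝ) - 2 * α) / 2)))) := by
  set β : ℝ := ((N : ℝ) - 2 * α) / 2 with hβ
  have hβ0 : 0 < β := by rw [hβ]; linarith
  have hc := unitBallVol_pos N
  set c := unitBallVol N
  set S : ℝ → ℝ → ℝ → ℝ := fun k a b =>
    Real.sqrt (k ^ ((N : ℝ) + 2 * α) / (c * a ^ (N : ℝ) * (c * b ^ (N : ℝ)))) with hS
  have hS0 : ∀ k a b, 0 ≤ S k a b := fun _ _ _ => Real.sqrt_nonneg _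
  set q : ℝ := 2 ^ (-β) with hq
  have hq0 : 0 < q := by positivity
  have hq1 : q < 1 := Real.rpow_lt_one_of_one_lt_of_neg one_lt_two (by linarith)
  have h1q : 0 < 1 - q := by linarith
  have hpow : ∀ n : ℕ, ((2 : ℝ) ^ n) ^ (-β) = q ^ n := by
    intro n
    rw [hq, ← Real.rpow_natCast, ← Real.rpow_natCast, ← Real.rpow_mul (by norm_num),
      ← Real.rpow_mul (by norm_num), mul_comm]
  refine ⟨S 3 1 2 / (1 - q) + S 3 2 1 / (1 - q), add_nonneg (div_nonneg (hS0 _ _ _) h1q.le)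
    (div_nonneg (hS0 _ _ _) h1q.le), ?_⟩
  intro u hu hgag x r hr
  have step : ∀ (y z : EN N) (ρ k a b : ℝ), 0 < ρ → 0 < k → 0 < a → 0 < b →
      dist y z + ρ * a + ρ * b ≤ ρ * k →
      ballAvg u y (ρ * a) ≤ ballAvg u z (ρ * b) + ENNReal.ofReal (S k a b * ρ ^ (-β)) := by
    intro y z ρ k a b hρ hk ha hb hd
    have := ballAvg_le_ballAvg_add hα hu hgag (mul_pos hρ ha) (mul_pos hρ hb) hd
    rwa [sqrt_rpow_div_ball_scale hc hρ hk ha hb] at this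
  have up : ∀ n : ℕ, ballAvg u x r ≤ ballAvg u x (2 ^ n * r) +
      ENNReal.ofReal (S 3 1 2 * r ^ (-β) / (1 - q)) := by
    intro n
    have := le_add_ofReal_geometric_of_le_succ (b := fun n => ballAvg u x (2 ^ n * r))
      (C := S 3 1 2 * r ^ (-β)) (mul_nonneg (hS0 _ _ _) (by positivity)) hq0.le hq1 ?_ n
    · simpa using this
    · intro n
      have := step x x (2 ^ n * r) 3 1 2 (by positivity) (by norm_num) (by norm_num) (by norm_num)
        (by rw [dist_self]; linarith)
      rw [Real.mul_rpow (by positivity) hr.le, hpow, mul_one,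
        show (2 : ℝ) ^ n * r * 2 = 2 ^ (n + 1) * r by ring,
        show S 3 1 2 * (q ^ n * r ^ (-β)) = S 3 1 2 * r ^ (-β) * q ^ n by
          rw [mul_comm (q ^ n), mul_assoc]] at this
      exact this
  have down : ∀ n : ℕ, ballAvg u 0 (2 ^ n) ≤ ballAvg u 0 1 +
      ENNReal.ofReal (S 3 2 1 / (1 - q)) := by
    intro n
    have := le_add_ofReal_geometric_of_succ_le (b := fun n => ballAvg u 0 (2 ^ n))
      (C := S 3 2 1) (hS0 _ _ _) hq0.le hq1 ?_ n
    · simpa using this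
    · intro n
      have := step 0 0 (2 ^ n) 3 2 1 (by positivity) (by norm_num) (by norm_num) (by norm_num)
        (by rw [dist_self]; linarith)
      rw [hpow, mul_one] at this
      rwa [pow_succ]
  have across : ∀ᶠ n : ℕ in atTop, ballAvg u x r ≤ ballAvg u 0 1 +
      (ENNReal.ofReal (S 3 2 1 / (1 - q)) + ENNReal.ofReal (S 3 1 2 * r ^ (-β) / (1 - q))) +
        ENNReal.ofReal (S (r + 2) r 1 * q ^ n) := by
    filter_upwards [(tendsto_pow_atTop_atTop_of_one_lt (one_lt_two (α := ℝ))).eventually_ge_atTop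
      ‖x‖] with n hn
    have h := step x 0 (2 ^ n) (r + 2) r 1 (by positivity) (by positivity) hr one_pos
      (by rw [dist_zero_right]; linarith)
    rw [hpow, mul_one] at h
    calc ballAvg u x r ≤ _ := up n
      _ ≤ _ := add_le_add_left h _
      _ ≤ _ := add_le_add_left (add_le_add_left (down n) _) _
      _ = _ := by ring
  have hlim : Tendsto (fun n : ℕ => ballAvg u 0 1 +
      (ENNReal.ofReal (S 3 2 1 / (1 - q)) + ENNReal.ofReal (S 3 1 2 * r ^ (-β) / (1 - q))) +
        ENNReal.ofReal (S (r + 2) r 1 * q ^ n)) atTop (nhds (ballAvg u 0 1 +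
      (ENNReal.ofReal (S 3 2 1 / (1 - q)) + ENNReal.ofReal (S 3 1 2 * r ^ (-β) / (1 - q))) +
        0)) := by
    refine tendsto_const_nhds.add ?_
    rw [← ENNReal.ofReal_zero]
    refine ENNReal.tendsto_ofReal ?_
    simpa using (tendsto_pow_atTop_nhds_zero_of_lt_one hq0.le hq1).const_mul (S (r + 2) r 1)
  refine (ge_of_tendsto hlim across).trans ?_
  rw [add_zero, ← ENNReal.ofReal_add (div_nonneg (hS0 _ _ _) h1q.le)
    (div_nonneg (mul_nonneg (hS0 _ _ _) (by positivity)) h1q.le)]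
  refine add_le_add_right (ENNReal.ofReal_le_ofReal ?_) _
  have hr' : 0 ≤ r ^ (-β) := by positivity
  have ha : 0 ≤ S 3 1 2 / (1 - q) := div_nonneg (hS0 _ _ _) h1q.le
  have hb : 0 ≤ S 3 2 1 / (1 - q) := div_nonneg (hS0 _ _ _) h1q.le
  have : S 3 1 2 * r ^ (-β) / (1 - q) = S 3 1 2 / (1 - q) * r ^ (-β) := by ring
  rw [this]
  nlinarith [mul_nonneg hb hr']

theorem enorm_le_ballAvg_add {N : ℕ} {α : ℝ} (hα : 0 < α) {u : EN N → ℝ} (hu : Measurable u)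
    {x : EN N} {r d : ℝ} (hr : 0 < r) (hd : 0 ≤ d)
    (hx : ∫⁻ y, gagKer α u (x, y) ≤ ENNReal.ofReal d) :
    ‖u x‖ₑ ≤ ballAvg u x r +
      ENNReal.ofReal (Real.sqrt (1 / unitBallVol N) * (r ^ α * Real.sqrt d)) := by
  have hc := unitBallVol_pos N
  set R := unitBallVol N * r ^ (N : ℝ) with hR
  have hRp : 0 < R := by positivity
  have hcs : ∫⁻ y in Metric.ball x r, ‖u x - u y‖ₑ ≤
      ENNReal.ofReal (Real.sqrt (R * (r ^ ((N : ℝ) + 2 * α) * d))) := by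
    refine lintegral_le_ofReal_sqrt Metric.isOpen_ball.measurableSet
      (h := fun y => gagKer α u (x, y)) (by fun_prop)
      ((measurable_gagKer α hu).comp measurable_prodMk_left).aemeasurable
      (by positivity) (by positivity) hd ?_ ?_ hx
    · intro y hy
      refine enorm_sub_sq_le_gagKer hα u (p := (x, y)) ?_
      have h1 : dist y x < r := hy
      rw [dist_comm, dist_eq_norm] at h1
      exact h1.le
    · rw [volume_ball_eq x hr]
  have hmain : ‖u x‖ₑ * ENNReal.ofReal R ≤ (∫⁻ z in Metric.ball x r, ‖u z‖ₑ) +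
        ENNReal.ofReal (Real.sqrt (R * (r ^ ((N : ℝ) + 2 * α) * d))) := by
    refine le_trans ?_ (add_le_add_right hcs _)
    rw [← volume_ball_eq x hr, ← setLIntegral_const, ← lintegral_add_left (by fun_prop)]
    refine lintegral_mono fun p => ?_
    simpa using enorm_add_le (u p) (u x - u p)
  have hR0 : ENNReal.ofReal R ≠ 0 := by simpa using hRp
  unfold ballAvg
  rw [volume_ball_eq x hr, ← hR, ← ENNReal.mul_le_mul_iff_left hR0 ENNReal.ofReal_ne_top]
  refine hmain.trans (le_of_eq ?_)
  rw [add_mul, ENNReal.div_mul_cancel hR0 ENNReal.ofReal_ne_top, ← ENNReal.ofReal_mul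
    (by positivity)]
  congr 2
  have e1 : r ^ ((N : ℝ) + 2 * α) = r ^ (N : ℝ) * (r ^ α * r ^ α) := by
    rw [← Real.rpow_add hr, ← Real.rpow_add hr]
    congr 1
    ring
  have e : R * (r ^ ((N : ℝ) + 2 * α) * d) =
      1 / unitBallVol N * d * ((R * r ^ α) * (R * r ^ α)) := by
    rw [e1, hR]
    field_simp
  rw [e, Real.sqrt_mul (by positivity), Real.sqrt_mul_self (by positivity),
    Real.sqrt_mul (by positivity)]
  ring

theorem le_mul_rpow_of_forall_le_rpow {n α w a b d : ℝ} (hα : 0 < α) (hn : 2 * α < n)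
    (hd : 0 ≤ d)
    (h : ∀ r : ℝ, 0 < r → w ≤ a * r ^ (-((n - 2 * α) / 2)) + b * (r ^ α * Real.sqrt d)) :
    w ≤ (a + b) * d ^ ((n - 2 * α) / (2 * n)) := by
  have hn0 : 0 < n := by linarith
  rcases hd.eq_or_lt with rfl | hd
  · rw [Real.zero_rpow (div_pos (by linarith) (by linarith)).ne', mul_zero]
    have hlim : Tendsto (fun r : ℝ => a * r ^ (-((n - 2 * α) / 2))) atTop (nhds (a * 0)) :=
      (tendsto_rpow_neg_atTop (by linarith)).const_mul a
    rw [mul_zero] at hlim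
    refine ge_of_tendsto hlim ?_
    filter_upwards [eventually_gt_atTop 0] with r hr
    simpa using h r hr
  · refine (h (d ^ (-(1 / n))) (by positivity)).trans (le_of_eq ?_)
    rw [Real.sqrt_eq_rpow, ← Real.rpow_mul hd.le, ← Real.rpow_mul hd.le, ← Real.rpow_add hd,
      add_mul]
    congr 3
    · field_simp
    · field_simp
      ring

/-- The pointwise form of the fractional Sobolev inequality, modulo a bounded function. -/
theorem exists_abs_le_add_rpow {N : ℕ} {α : ℝ} (hα : 0 < α) (hN : 2 * α < N) {A : ℝ}
    (hA : 0 ≤ A) :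
    ∃ C : ℝ, 0 < C ∧ ∀ u : EN N → ℝ, Measurable u → gagSq N α u ≤ 1 →
      ballAvg u 0 1 ≤ ENNReal.ofReal A → ∀ (x : EN N) (d : ℝ), 0 ≤ d →
        ∫⁻ y, gagKer α u (x, y) ≤ ENNReal.ofReal d →
          |u x| ≤ C + C * d ^ (((N : ℝ) - 2 * α) / (2 * N)) := by
  obtain ⟨M, hM, hMu⟩ := exists_ballAvg_le hα hN
  set B := Real.sqrt (1 / unitBallVol N) with hB
  have hB0 : 0 ≤ B := Real.sqrt_nonneg _
  refine ⟨A + M + B + 1, by positivity, ?_⟩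
  intro u hu hgag hAu x d hd hx
  have key : |u x| - (A + M) ≤ (M + B) * d ^ (((N : ℝ) - 2 * α) / (2 * N)) := by
    refine le_mul_rpow_of_forall_le_rpow hα hN hd fun r hr => ?_
    have h : ‖u x‖ₑ ≤ ENNReal.ofReal (A + M * (1 + r ^ (-(((N : ℝ) - 2 * α) / 2))) +
        B * (r ^ α * Real.sqrt d)) := by
      rw [ENNReal.ofReal_add (by positivity) (by positivity),
        ENNReal.ofReal_add (by positivity) (by positivity)]
      exact (enorm_le_ballAvg_add hα hu hr hd hx).trans (add_le_add_left
        ((hMu u hu hgag x r hr).trans (add_le_add_left hAu _)) _)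
    rw [Real.enorm_eq_ofReal_abs, ENNReal.ofReal_le_ofReal_iff (by positivity)] at h
    linarith
  have hp : 0 ≤ d ^ (((N : ℝ) - 2 * α) / (2 * N)) := by positivity
  nlinarith [mul_nonneg hA hp]

theorem lintegral_gagKer {N : ℕ} (α : ℝ) {u : EN N → ℝ} (hu : Measurable u) :
    ∫⁻ x, ∫⁻ y, gagKer α u (x, y) = gagSq N α u := by
  rw [← lintegral_prod _ (measurable_gagKer α hu).aemeasurable]
  rfl

theorem normSq_const_mul {N : ℕ} (α : ℝ) (V u : EN N → ℝ) (t : ℝ) :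
    normSq α V (fun x => t * u x) = ENNReal.ofReal (t ^ 2) * normSq α V u := by
  unfold normSq gagSq
  rw [mul_add, ← lintegral_const_mul' _ _ ENNReal.ofReal_ne_top,
    ← lintegral_const_mul' _ _ ENNReal.ofReal_ne_top]
  congr 2
  · funext p
    rw [← ENNReal.ofReal_mul (sq_nonneg t)]
    congr 1
    ring
  · funext x
    rw [← ENNReal.ofReal_mul (sq_nonneg t)]
    congr 1
    ring

theorem exists_ballAvg_zero_le {N : ℕ} {V : EN N → ℝ} (hV : Continuous V) (hpos : ∀ x, 0 < V x) :
    ∃ A : ℝ, 0 ≤ A ∧ ∀ u : EN N → ℝ, Measurable u →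
      ∫⁻ x, ENNReal.ofReal (V x * u x ^ 2) ≤ 1 → ballAvg u 0 1 ≤ ENNReal.ofReal A := by
  obtain ⟨M, hM⟩ := (isCompact_closedBall (0 : EN N) 1).exists_bound_of_continuousOn
    (hV.inv₀ fun x => (hpos x).ne').continuousOn
  have hM0 : 0 ≤ M := (norm_nonneg _).trans (hM 0 (by simp))
  have hc := unitBallVol_pos N
  have hvol : volume (Metric.ball (0 : EN N) 1) = ENNReal.ofReal (unitBallVol N) := by
    simpa using volume_ball_eq (0 : EN N) one_pos
  refine ⟨Real.sqrt (unitBallVol N * (M * 1)) / unitBallVol N, by positivity, ?_⟩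
  intro u hu hint
  unfold ballAvg
  rw [hvol, ENNReal.ofReal_div_of_pos hc]
  gcongr
  refine lintegral_le_ofReal_sqrt Metric.isOpen_ball.measurableSet
    (h := fun x => ENNReal.ofReal (V x * u x ^ 2)) (by fun_prop)
    (by have := hV.measurable; fun_prop) hc.le hM0 zero_le_one ?_ hvol.le (by simpa using hint)
  intro x hx
  have hx' := hM x (Metric.ball_subset_closedBall hx)
  rw [Pi.inv_apply, Real.norm_of_nonneg (inv_nonneg.2 (hpos x).le), inv_le_iff_one_le_mul₀ (hpos x)] at hx'
  rw [← ENNReal.ofReal_mul hM0, Real.enorm_eq_ofReal_abs, ← ENNReal.ofReal_pow (abs_nonneg _),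
    sq_abs]
  refine ENNReal.ofReal_le_ofReal ?_
  nlinarith [sq_nonneg (u x)]

/-- Subcritical growth: `f(s) s ≤ ε s²` for small `s` and `f(s) s ≤ C |s|^p` otherwise. -/
theorem exists_mul_self_le {f : ℝ → ℝ} (hf : Continuous f) {p : ℝ} (hp : 0 ≤ p) (hf1 : Cf1 f)
    (hf2 : Cf2 f p) {ε : ℝ} (hε : 0 < ε) :
    ∃ δ C : ℝ, 0 < δ ∧ 0 ≤ C ∧ (∀ s, |s| < δ → f s * s ≤ ε * s ^ 2) ∧
      ∀ s, δ ≤ |s| → f s * s ≤ C * |s| ^ p := by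
  have h1 := (tendsto_order.1 (hf1.abs)).2 ε (by simpa using hε)
  rw [eventually_nhdsWithin_iff, Metric.eventually_nhds_iff] at h1
  obtain ⟨δ, hδ, h1⟩ := h1
  have h2 := (tendsto_order.1 (hf2.abs)).2 1 (by simp)
  rw [eventually_comap] at h2
  obtain ⟨T, h2⟩ := eventually_atTop.1 h2
  obtain ⟨M, hM⟩ := (isCompact_Icc (a := -T) (b := T)).exists_bound_of_continuousOn
    (hf.continuousOn)
  have hmul : ∀ s, f s * s ≤ |f s| * |s| := fun s => (le_abs_self _).trans (abs_mul _ _).le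
  refine ⟨δ, 1 + |M * T| / δ ^ p, hδ, by positivity, ?_, ?_⟩
  · intro s hs
    rcases eq_or_ne s 0 with rfl | hs0
    · simp
    · have h := h1 (by simpa using hs) hs0
      have hs' : 0 < |s| := abs_pos.2 hs0
      rw [abs_div, abs_abs, div_lt_iff₀ hs'] at h
      rw [← sq_abs s]
      nlinarith [hmul s]
  · intro s hs
    have hs' : 0 < |s| := hδ.trans_le hs
    have hsp : 0 < |s| ^ p := by positivity
    rcases le_total T |s| with hT | hT
    · have h := h2 |s| hT s rfl
      rw [abs_div, abs_of_pos (a := |s| ^ (p - 1)) (by positivity), div_lt_one (by positivity),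
        Real.rpow_sub_one hs'.ne', lt_div_iff₀ hs'] at h
      have : 0 ≤ |M * T| / δ ^ p * |s| ^ p := by positivity
      linarith [hmul s]
    · have h := hM s (abs_le.1 hT)
      rw [Real.norm_eq_abs] at h
      have hM0 : 0 ≤ M := (abs_nonneg _).trans h
      have hle : δ ^ p ≤ |s| ^ p := by gcongr
      have h3 : |f s| * |s| ≤ |M * T| :=
        (mul_le_mul h hT hs'.le hM0).trans (le_abs_self _)
      have h4 : |M * T| ≤ |M * T| / δ ^ p * |s| ^ p := by
        rw [div_mul_eq_mul_div, le_div_iff₀ (by positivity)]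
        gcongr
      linarith [hmul s]

theorem ofReal_le_lintegral_of_integral_eq {X : Type*} [MeasurableSpace X] {μ : Measure X}
    {g : X → ℝ} {a : ℝ} (ha : a = ∫ x, g x ∂μ) :
    ENNReal.ofReal a ≤ ∫⁻ x, ENNReal.ofReal (g x) ∂μ := by
  by_cases hg : Integrable g μ
  · rw [ha, integral_eq_lintegral_pos_part_sub_lintegral_neg_part hg]
    refine ENNReal.ofReal_le_of_le_toReal ?_
    linarith [ENNReal.toReal_nonneg (a := ∫⁻ x, ENNReal.ofReal (-g x) ∂μ)]
  · rw [ha, integral_undef hg]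
    simp

end ZeroMass

open ZeroMass
/-- Lemma 3.1(b), uniform lower bound: there is `τ > 0` such that `t_u ≥ τ` for
every `u` on the unit sphere of `X`. -/
theorem statement13 {N : ℕ} (α : ℝ) (hα : α ∈ Set.Ioo (0 : ℝ) 1) (hN : 2 * α < N)
    (V K : EN N → ℝ) (f : ℝ → ℝ)
    (hV : Continuous V) (hK : Continuous K) (hf : Continuous f)
    (h1 : H1 V K) (h2 : H2 K) (h3 : H3 V K)
    (hf1 : Cf1 f) (hf2 : Cf2 f (critExp N α)) (hf3 : Cf3 f) (hf4 : Cf4 f) :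
    ∃ τ : ℝ, 0 < τ ∧ ∀ u : EN N → ℝ, memX α V u → Xnorm α V u = 1 →
      ∀ t : ℝ, 0 < t → memNehari2 α V K f (fun x => t * u x) → τ ≤ t := by
  have hα0 : 0 < α := hα.1
  have hN0 : (0 : ℝ) < N := by linarith
  have hsub : (0 : ℝ) < N - 2 * α := by linarith
  obtain ⟨hVpos, hKpos, Km, hKm⟩ := h1
  obtain ⟨CV, hCV⟩ := h3
  set p := critExp N α with hp
  set γ : ℝ := ((N : ℝ) - 2 * α) / (2 * N) with hγ
  have hp2 : 0 < p - 2 := by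
    have : p - 2 = 4 * α / (N - 2 * α) := by
      rw [hp, critExp]
      field_simp
      ring
    rw [this]
    positivity
  have hp0 : 0 < p := by linarith
  have hγp : γ * p = 1 := by
    rw [hp, critExp, hγ]
    field_simp
  have hCV0 : 0 < CV := (div_pos (hKpos 0) (hVpos 0)).trans_le (hCV 0)
  have hKm0 : 0 < Km := (hKpos 0).trans_le (hKm 0)
  obtain ⟨δ, Cf, hδ, hCf, hsmall, hlarge⟩ :=
    exists_mul_self_le hf hp0.le hf1 hf2 (ε := 1 / (2 * CV)) (by positivity)
  obtain ⟨A, hA, hAu⟩ := exists_ballAvg_zero_le hV hVpos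
  obtain ⟨C, hC, hCu⟩ := exists_abs_le_add_rpow hα0 hN hA
  set B := Km * Cf * (2 * C) ^ p with hB
  have hB0 : 0 ≤ B := by positivity
  refine ⟨min (δ / (2 * C)) ((1 / (2 * (B + 1))) ^ (1 / (p - 2))), by positivity, ?_⟩
  intro u hu hu1 t ht hnehari
  by_contra! hlt
  obtain ⟨ht1, ht2⟩ := lt_min_iff.1 hlt
  have hnorm : normSq α V u = 1 := by
    rw [Xnorm, ← Real.sqrt_eq_rpow, Real.sqrt_eq_one] at hu1
    exact (ENNReal.toReal_eq_one_iff _).1 hu1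
  have hgag : gagSq N α u ≤ 1 := hnorm ▸ le_self_add
  have hVu : ∫⁻ x, ENNReal.ofReal (V x * u x ^ 2) ≤ 1 := hnorm ▸ le_add_self
  set D : EN N → ENNReal := fun x => ∫⁻ y, gagKer α u (x, y) with hD
  have hDm : Measurable D := (measurable_gagKer α hu.1).lintegral_prod_right'
  have hDint : ∫⁻ x, D x ≤ 1 := (lintegral_gagKer α hu.1).trans_le hgag
  have hDfin : ∀ᵐ x, D x < ⊤ := ae_lt_top hDm (hDint.trans_lt ENNReal.one_lt_top).ne
  have hpt : ∀ᵐ x, ENNReal.ofReal (K x * f (t * u x) * (t * u x)) ≤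
      ENNReal.ofReal (t ^ 2 / 2) * ENNReal.ofReal (V x * u x ^ 2) +
        ENNReal.ofReal (B * t ^ p) * D x := by
    filter_upwards [hDfin] with x hx
    obtain ⟨d, hd, hdx⟩ : ∃ d : ℝ, 0 ≤ d ∧ D x = ENNReal.ofReal d :=
      ⟨(D x).toReal, ENNReal.toReal_nonneg, (ENNReal.ofReal_toReal hx.ne).symm⟩
    have hVx := hVpos x
    have hKx := hKpos x
    rw [hdx, ← ENNReal.ofReal_mul (by positivity), ← ENNReal.ofReal_mul (by positivity),
      ← ENNReal.ofReal_add (by positivity) (by positivity), mul_assoc]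
    refine ENNReal.ofReal_le_ofReal ?_
    rcases lt_or_ge |t * u x| δ with hs | hs
    · have h := mul_le_mul_of_nonneg_left (hsmall _ hs) hKx.le
      have hKV : K x ≤ CV * V x := (div_le_iff₀ hVx).1 (hCV x)
      have h' : K x * (1 / (2 * CV) * (t * u x) ^ 2) ≤ t ^ 2 / 2 * (V x * u x ^ 2) := by
        calc K x * (1 / (2 * CV) * (t * u x) ^ 2)
            ≤ CV * V x * (1 / (2 * CV) * (t * u x) ^ 2) := by gcongr
          _ = _ := by field_simp
      have : 0 ≤ B * t ^ p * d := by positivity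
      linarith
    · have hux := hCu u hu.1 hgag (hAu u hu.1 hVu) x d hd hdx.le
      rw [lt_div_iff₀ (by positivity)] at ht1
      have hbig : 2 * C ≤ |u x| := by
        rw [abs_mul, abs_of_pos ht] at hs
        by_contra! hcon
        nlinarith
      have hux2 : |u x| ≤ 2 * C * d ^ γ := by linarith
      have hup : |u x| ^ p ≤ (2 * C) ^ p * d := by
        calc |u x| ^ p ≤ (2 * C * d ^ γ) ^ p := by gcongr
          _ = _ := by
            rw [Real.mul_rpow (by positivity) (by positivity), ← Real.rpow_mul hd, hγp,
              Real.rpow_one]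
      have h := mul_le_mul_of_nonneg_left (hlarge _ hs) hKx.le
      have h' : K x * (Cf * |t * u x| ^ p) ≤ B * t ^ p * d := by
        rw [abs_mul, abs_of_pos ht, Real.mul_rpow ht.le (abs_nonneg _)]
        calc K x * (Cf * (t ^ p * |u x| ^ p))
            ≤ Km * (Cf * (t ^ p * ((2 * C) ^ p * d))) := by
              gcongr
              exact hKm x
          _ = _ := by rw [hB]; ring
      have : 0 ≤ t ^ 2 / 2 * (V x * u x ^ 2) := by positivity
      linarith
  have hVm : Measurable fun x => ENNReal.ofReal (V x * u x ^ 2) := by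
    have h1 := hV.measurable
    have h2 := hu.1
    fun_prop
  have hle : ENNReal.ofReal (t ^ 2) ≤ ENNReal.ofReal (t ^ 2 / 2 + B * t ^ p) := by
    have hn := hnehari.2.2
    rw [normSq_const_mul, hnorm, mul_one, ENNReal.toReal_ofReal (by positivity)] at hn
    calc ENNReal.ofReal (t ^ 2) ≤ _ := ofReal_le_lintegral_of_integral_eq hn
      _ ≤ _ := lintegral_mono_ae hpt
      _ = ENNReal.ofReal (t ^ 2 / 2) * (∫⁻ x, ENNReal.ofReal (V x * u x ^ 2)) +
          ENNReal.ofReal (B * t ^ p) * ∫⁻ x, D x := by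
        rw [lintegral_add_left (hVm.const_mul _), lintegral_const_mul _ hVm,
          lintegral_const_mul _ hDm]
      _ ≤ ENNReal.ofReal (t ^ 2 / 2) * 1 + ENNReal.ofReal (B * t ^ p) * 1 := by gcongr
      _ = _ := by
        rw [mul_one, mul_one, ENNReal.ofReal_add (by positivity) (by positivity)]
  rw [ENNReal.ofReal_le_ofReal_iff (by positivity)] at hle
  have htp : t ^ p = t ^ 2 * t ^ (p - 2) := by
    rw [← Real.rpow_natCast, ← Real.rpow_add ht]
    congr 1
    push_cast
    ring
  have hsmallt : t ^ (p - 2) < 1 / (2 * (B + 1)) := by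
    have := Real.rpow_lt_rpow ht.le ht2 hp2
    rwa [← Real.rpow_mul (by positivity), one_div_mul_cancel hp2.ne', Real.rpow_one] at this
  rw [lt_div_iff₀ (by positivity)] at hsmallt
  have htpos : 0 < t ^ (p - 2) := by positivity
  have ht2pos : 0 < t ^ 2 := by positivity
  rw [htp] at hle
  have hhalf : B * t ^ (p - 2) < 1 / 2 := by nlinarith
  nlinarith [mul_lt_mul_of_pos_left hhalf ht2pos]
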